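/- arXiv:2109.01080 — 3 statements merged into one kernel-verified Lean document; each statement's English description precedes it below -/
import Mathlib

section
/- Let n ≥ 1, let μ be the Haar probability measure on the unitary group U(n), and let α = (α₁,…,αₙ) be nonnegative integers with Σᵢ αᵢ = d. Then ∫_{U(n)} ∏_{i=1}^{n} |Uᵢ₁|^{2αᵢ} dμ(U) = α₁! ⋯ αₙ! (n−1)! / (d+n−1)!, where Uᵢ₁ denotes the (i,1) entry of U (so (U₁₁,…,Uₙ₁) is the first column of U, a uniformly distributed point of the complex unit sphere). -/
open Matrix MeasureTheory

noncomputable instance (n : ℕ) : MeasurableSpace (Matrix (Fin n) (Fin n) ℂ) := borel _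

open scoped ComplexConjugate

namespace Matrix.UnitaryGroup

variable {ι : Type*} [Fintype ι] [DecidableEq ι]

instance compactSpace : CompactSpace (unitaryGroup ι ℂ) := by
  refine isCompact_iff_compactSpace.mp ?_
  have hball : IsCompact (Set.univ.pi fun _ : ι => Set.univ.pi fun _ : ι =>
      Metric.closedBall (0 : ℂ) 1) :=
    isCompact_univ_pi fun _ => isCompact_univ_pi fun _ => isCompact_closedBall _ _
  refine hball.of_isClosed_subset ?_ fun U hU i _ j _ => ?_
  · have hcont : Continuous fun A : Matrix ι ι ℂ => A * star A := by fun_prop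
    have hset : ((unitaryGroup ι ℂ : Submonoid (Matrix ι ι ℂ)) : Set (Matrix ι ι ℂ)) =
        {A | A * star A = 1} := by
      ext A
      exact mem_unitaryGroup_iff
    rw [hset]
    exact isClosed_eq hcont continuous_const
  · simpa using entry_norm_bound_of_unitary hU i j

/-- The orthogonal projection onto the span of the `i`-th and `j`-th basis vectors. -/
def planeProjection (i j : ι) : Matrix ι ι ℂ := single i i 1 + single j j 1

/-- The quarter turn of the plane spanned by the `i`-th and `j`-th basis vectors. -/
def planeQuarterTurn (i j : ι) : Matrix ι ι ℂ := single j i 1 - single i j 1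

/-- Rotation by the angle `θ` in the plane of the `i`-th and `j`-th coordinates. -/
noncomputable def planeRotation (i j : ι) (hij : i ≠ j) (θ : ℝ) : unitaryGroup ι ℂ :=
  ⟨1 + (Complex.cos θ - 1) • planeProjection i j + Complex.sin θ • planeQuarterTurn i j, by
    have hPP : planeProjection i j * planeProjection i j = planeProjection i j := by
      simp [planeProjection, mul_add, add_mul, single_mul_single_of_ne, hij, hij.symm]
    have hPQ : planeProjection i j * planeQuarterTurn i j = planeQuarterTurn i j := by
      simp [planeProjection, planeQuarterTurn, mul_sub, add_mul, single_mul_single_of_ne, hij,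
        hij.symm]
    have hQP : planeQuarterTurn i j * planeProjection i j = planeQuarterTurn i j := by
      simp [planeProjection, planeQuarterTurn, mul_add, sub_mul, single_mul_single_of_ne, hij,
        hij.symm, ← sub_eq_add_neg]
    have hQQ : planeQuarterTurn i j * planeQuarterTurn i j = -planeProjection i j := by
      simp [planeProjection, planeQuarterTurn, mul_sub, sub_mul, single_mul_single_of_ne, hij,
        hij.symm]
      abel
    have hP : star (planeProjection i j) = planeProjection i j := by
      simp [planeProjection, star_eq_conjTranspose]
    have hQ : star (planeQuarterTurn i j) = -planeQuarterTurn i j := by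
      simp [planeQuarterTurn, star_eq_conjTranspose]
    have hcos : star (Complex.cos θ) = Complex.cos θ := by
      simp [← Complex.cos_conj]
    have hsin : star (Complex.sin θ) = Complex.sin θ := by
      simp [← Complex.sin_conj]
    rw [mem_unitaryGroup_iff]
    simp only [star_add, star_smul, star_sub, star_one, hP, hQ, hcos, hsin, mul_add, add_mul,
      smul_mul_assoc, mul_smul_comm, hPP, hPQ, hQP, hQQ, mul_one, one_mul, mul_neg,
      smul_neg]
    linear_combination (norm := module) (Complex.cos_sq_add_sin_sq (θ : ℂ)) • planeProjection i j⟩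

lemma planeRotation_mul_apply_left {i j : ι} (hij : i ≠ j) (θ : ℝ) (U : unitaryGroup ι ℂ) (l : ι) :
    (planeRotation i j hij θ * U : unitaryGroup ι ℂ) i l =
      Complex.cos θ * U i l - Complex.sin θ * U j l := by
  simp [planeRotation, planeProjection, planeQuarterTurn, add_mul, sub_mul,
    single_mul_apply_of_ne, hij]
  ring

lemma planeRotation_mul_apply_right {i j : ι} (hij : i ≠ j) (θ : ℝ) (U : unitaryGroup ι ℂ)
    (l : ι) :
    (planeRotation i j hij θ * U : unitaryGroup ι ℂ) j l =
      Complex.sin θ * U i l + Complex.cos θ * U j l := by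
  simp [planeRotation, planeProjection, planeQuarterTurn, add_mul, sub_mul,
    single_mul_apply_of_ne, hij.symm]
  ring

lemma planeRotation_mul_apply_of_ne {i j k : ι} (hij : i ≠ j) (hki : k ≠ i) (hkj : k ≠ j) (θ : ℝ)
    (U : unitaryGroup ι ℂ) (l : ι) :
    (planeRotation i j hij θ * U : unitaryGroup ι ℂ) k l = U k l := by
  simp [planeRotation, planeProjection, planeQuarterTurn, add_mul, sub_mul,
    single_mul_apply_of_ne, hki, hkj]

lemma hasDerivAt_planeRotation_mul_apply_left {i j : ι} (hij : i ≠ j) (θ : ℝ)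
    (U : unitaryGroup ι ℂ) (l : ι) :
    HasDerivAt (fun t => (planeRotation i j hij t * U : unitaryGroup ι ℂ) i l)
      (-(planeRotation i j hij θ * U : unitaryGroup ι ℂ) j l) θ := by
  simp only [planeRotation_mul_apply_left, planeRotation_mul_apply_right]
  refine (((Complex.hasDerivAt_cos (θ : ℂ)).comp_ofReal.mul_const (U i l)).fun_sub
    ((Complex.hasDerivAt_sin (θ : ℂ)).comp_ofReal.mul_const (U j l))).congr_deriv ?_
  ring

lemma hasDerivAt_planeRotation_mul_apply_right {i j : ι} (hij : i ≠ j) (θ : ℝ)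
    (U : unitaryGroup ι ℂ) (l : ι) :
    HasDerivAt (fun t => (planeRotation i j hij t * U : unitaryGroup ι ℂ) j l)
      ((planeRotation i j hij θ * U : unitaryGroup ι ℂ) i l) θ := by
  simp only [planeRotation_mul_apply_left, planeRotation_mul_apply_right]
  refine (((Complex.hasDerivAt_sin (θ : ℂ)).comp_ofReal.mul_const (U i l)).fun_add
    ((Complex.hasDerivAt_cos (θ : ℂ)).comp_ofReal.mul_const (U j l))).congr_deriv ?_
  ring

/-- The diagonal unitary matrix multiplying the `i`-th coordinate by the imaginary unit. -/
noncomputable def phaseShift (i : ι) : unitaryGroup ι ℂ :=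
  ⟨diagonal (Function.update 1 i Complex.I), by
    rw [mem_unitaryGroup_iff, star_eq_conjTranspose, diagonal_conjTranspose, diagonal_mul_diagonal,
      ← diagonal_one]
    congr 1
    ext k
    by_cases hk : k = i
    · subst hk
      simp
    · simp [hk]⟩

lemma phaseShift_mul_apply_self (i : ι) (U : unitaryGroup ι ℂ) (l : ι) :
    (phaseShift i * U : unitaryGroup ι ℂ) i l = Complex.I * U i l := by
  simp [phaseShift, diagonal_mul]

lemma phaseShift_mul_apply_of_ne {i k : ι} (hk : k ≠ i) (U : unitaryGroup ι ℂ) (l : ι) :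
    (phaseShift i * U : unitaryGroup ι ℂ) k l = U k l := by
  simp [phaseShift, diagonal_mul, hk]

lemma continuous_apply (i j : ι) : Continuous fun U : unitaryGroup ι ℂ => U i j :=
  continuous_subtype_val.matrix_elem i j

lemma sum_norm_sq_column (U : unitaryGroup ι ℂ) (l : ι) : ∑ k, ‖U k l‖ ^ 2 = 1 := by
  have h := congrFun (congrFun (mem_unitaryGroup_iff'.mp U.2) l) l
  simp only [Matrix.mul_apply, star_apply, one_apply_eq, RCLike.star_def, Complex.conj_mul'] at h
  exact_mod_cast h

/-- The monomial `x^p y^q (conj x)^s (conj y)^t` in the entries `x = Uᵢₗ` and `y = Uⱼₗ`,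
multiplied by `|Uₖₗ|^{2αₖ}` for all other indices `k`. -/
noncomputable def columnMonomial (l i j : ι) (α : ι → ℕ) (p q s t : ℕ) (U : unitaryGroup ι ℂ) : ℂ :=
  (∏ k ∈ (Finset.univ.erase i).erase j, (‖U k l‖ : ℂ) ^ (2 * α k)) *
    (U i l ^ p * U j l ^ q * conj (U i l) ^ s * conj (U j l) ^ t)

lemma continuous_columnMonomial (l i j : ι) (α : ι → ℕ) (p q s t : ℕ) :
    Continuous (columnMonomial l i j α p q s t) := by
  have hcont (k : ι) : Continuous fun U : unitaryGroup ι ℂ => U k l := continuous_apply k l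
  have hconj (k : ι) : Continuous fun U : unitaryGroup ι ℂ => conj (U k l) :=
    Complex.continuous_conj.comp (hcont k)
  exact (continuous_finsetProd _ fun k _ =>
    (Complex.continuous_ofReal.comp (hcont k).norm).pow _).mul
    (((((hcont i).pow p).mul ((hcont j).pow q)).mul ((hconj i).pow s)).mul ((hconj j).pow t))

lemma prod_erase_erase_congr {l i j : ι} {α β : ι → ℕ} {U V : unitaryGroup ι ℂ}
    (hα : ∀ k, k ≠ i → k ≠ j → α k = β k) (hU : ∀ k, k ≠ i → k ≠ j → U k l = V k l) :
    ∏ k ∈ (Finset.univ.erase i).erase j, (‖U k l‖ : ℂ) ^ (2 * α k) =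
      ∏ k ∈ (Finset.univ.erase i).erase j, (‖V k l‖ : ℂ) ^ (2 * β k) := by
  refine Finset.prod_congr rfl fun k hk => ?_
  simp only [Finset.mem_erase] at hk
  rw [hα k hk.2.1 hk.1, hU k hk.2.1 hk.1]

lemma columnMonomial_phaseShift_mul {i j : ι} (hij : i ≠ j) (l : ι) (α : ι → ℕ) (p q s t : ℕ)
    (U : unitaryGroup ι ℂ) :
    columnMonomial l i j α p q s t (phaseShift i * U) =
      Complex.I ^ p * (-Complex.I) ^ s * columnMonomial l i j α p q s t U := by
  rw [columnMonomial, prod_erase_erase_congr (V := U) (β := α) (fun _ _ _ => rfl)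
    (fun k hk _ => phaseShift_mul_apply_of_ne hk U l), phaseShift_mul_apply_self,
    phaseShift_mul_apply_of_ne hij.symm, map_mul, Complex.conj_I, mul_pow, mul_pow, columnMonomial]
  ring

lemma hasDerivAt_columnMonomial_planeRotation_mul {i j : ι} (hij : i ≠ j) (l : ι) (α : ι → ℕ)
    (p q s t : ℕ) (U : unitaryGroup ι ℂ) (θ : ℝ) :
    let V := planeRotation i j hij θ * U
    HasDerivAt (fun τ => columnMonomial l i j α p q s t (planeRotation i j hij τ * U))
      (q * columnMonomial l i j α (p + 1) (q - 1) s t V -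
        p * columnMonomial l i j α (p - 1) (q + 1) s t V +
        (t * columnMonomial l i j α p q (s + 1) (t - 1) V -
          s * columnMonomial l i j α p q (s - 1) (t + 1) V)) θ := by
  have hx := hasDerivAt_planeRotation_mul_apply_left hij θ U l
  have hy := hasDerivAt_planeRotation_mul_apply_right hij θ U l
  have hrest (τ : ℝ) := prod_erase_erase_congr (l := l) (α := α) (fun _ _ _ => rfl)
    (fun k hki hkj => planeRotation_mul_apply_of_ne hij hki hkj τ U l)
  simp only [columnMonomial, hrest]
  refine (((((hx.fun_pow p).fun_mul (hy.fun_pow q)).fun_mul (hx.star.fun_pow s)).fun_mul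
    (hy.star.fun_pow t)).const_mul _).congr_deriv ?_
  simp only [star_neg, starRingEnd_apply]
  ring

end Matrix.UnitaryGroup

namespace MeasureTheory

/-- If `H` is the derivative of `G` along a family of left translations, then `H` has zero mean
for every finite left-invariant measure on a compact group. -/
lemma integral_eq_zero_of_hasDerivAt_mul_left {K : Type*} [Group K] [TopologicalSpace K]
    [IsTopologicalGroup K] [CompactSpace K] [MeasurableSpace K] [BorelSpace K]
    (μ : Measure K) [IsFiniteMeasure μ] [μ.IsMulLeftInvariant] {G H : K → ℂ} (hG : Continuous G)
    (hH : Continuous H) (R : ℝ → K)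
    (hderiv : ∀ U θ, HasDerivAt (fun t => G (R t * U)) (H (R θ * U)) θ) :
    ∫ U, H U ∂μ = 0 := by
  have h_int (f : K → ℂ) (hf : Continuous f) : Integrable f μ :=
    hf.integrable_of_hasCompactSupport (HasCompactSupport.of_compactSpace f)
  have htrans (f : K → ℂ) (hf : Continuous f) (t : ℝ) : Continuous fun U => f (R t * U) := by
    fun_prop
  obtain ⟨C, hC⟩ := isCompact_univ.exists_bound_of_continuousOn hH.continuousOn
  have hmain := (hasDerivAt_integral_of_dominated_loc_of_deriv_le (μ := μ) (x₀ := (0 : ℝ))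
    (s := Set.univ) (F := fun t U => G (R t * U)) (F' := fun t U => H (R t * U))
    (bound := fun _ => C) Filter.univ_mem
    (.of_forall fun t => (h_int _ (htrans G hG t)).aestronglyMeasurable)
    (h_int _ (htrans G hG 0)) (h_int _ (htrans H hH 0)).aestronglyMeasurable
    (.of_forall fun U t _ => hC _ (Set.mem_univ _)) (integrable_const C)
    (.of_forall fun U t _ => hderiv U t)).2
  simp only [integral_mul_left_eq_self] at hmain
  exact hmain.unique (hasDerivAt_const _ _)

end MeasureTheory

namespace Matrix.UnitaryGroup

variable {ι : Type*} [Fintype ι] [DecidableEq ι] [MeasurableSpace (unitaryGroup ι ℂ)]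

/-- The integral of `∏ₖ |Uₖₗ|^{2αₖ}` over the unitary group. -/
noncomputable def columnMoment (μ : Measure (unitaryGroup ι ℂ)) (l : ι) (α : ι → ℕ) : ℝ :=
  ∫ U : unitaryGroup ι ℂ, ∏ k, ‖U k l‖ ^ (2 * α k) ∂μ

lemma ofReal_columnMoment (μ : Measure (unitaryGroup ι ℂ)) (l : ι) {i j : ι} (hij : i ≠ j)
    {α β : ι → ℕ} (hαβ : ∀ k, k ≠ i → k ≠ j → α k = β k) :
    (columnMoment μ l α : ℂ) =
      ∫ U, columnMonomial l i j β (α i) (α j) (α i) (α j) U ∂μ := by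
  rw [columnMoment, ← integral_complex_ofReal]
  refine integral_congr_ae (.of_forall fun U => ?_)
  dsimp only
  rw [columnMonomial, ← prod_erase_erase_congr hαβ fun _ _ _ => rfl,
    ← Finset.mul_prod_erase _ _ (Finset.mem_univ i), ← Finset.mul_prod_erase (Finset.univ.erase i)
    _ (Finset.mem_erase.mpr ⟨hij.symm, Finset.mem_univ j⟩)]
  push_cast
  rw [pow_mul, pow_mul, ← Complex.mul_conj', ← Complex.mul_conj', mul_pow, mul_pow]
  ring

variable [BorelSpace (unitaryGroup ι ℂ)]

lemma integral_columnMonomial_eq_zero (μ : Measure (unitaryGroup ι ℂ)) [μ.IsMulLeftInvariant]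
    {i j : ι} (hij : i ≠ j) (l : ι) (α : ι → ℕ) (q s t : ℕ) :
    ∫ U, columnMonomial l i j α (s + 2) q s t U ∂μ = 0 := by
  have hphase : Complex.I ^ (s + 2) * (-Complex.I) ^ s = -1 := by
    rw [pow_add, mul_right_comm, ← mul_pow]
    simp
  have h := integral_mul_left_eq_self (μ := μ) (columnMonomial l i j α (s + 2) q s t)
    (phaseShift i)
  simp only [columnMonomial_phaseShift_mul hij, hphase, neg_one_mul, integral_neg] at h
  exact self_eq_neg.mp h.symm

lemma columnMoment_add_single_comm (μ : Measure (unitaryGroup ι ℂ)) [IsFiniteMeasure μ]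
    [μ.IsMulLeftInvariant] (l : ι) (α : ι → ℕ) (i j : ι) :
    (α i + 1) * columnMoment μ l (α + Pi.single j 1) =
      (α j + 1) * columnMoment μ l (α + Pi.single i 1) := by
  obtain rfl | hij := eq_or_ne i j
  · rfl
  have hcont := continuous_columnMonomial l i j α
  have h_int (c : ℂ) (p q s t : ℕ) : Integrable (fun U => c * columnMonomial l i j α p q s t U) μ :=
    ((hcont p q s t).integrable_of_hasCompactSupport (HasCompactSupport.of_compactSpace _)).const_mul
      c
  have hsub_int (c c' : ℂ) (p q s t p' q' s' t' : ℕ) :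
      Integrable (fun U => c * columnMonomial l i j α p q s t U -
        c' * columnMonomial l i j α p' q' s' t' U) μ :=
    (h_int c p q s t).sub (h_int c' p' q' s' t')
  have hzero := integral_eq_zero_of_hasDerivAt_mul_left μ
    (H := fun U => α j * columnMonomial l i j α (α i + 2) (α j - 1) (α i) (α j + 1) U -
      (α i + 1 : ℕ) * columnMonomial l i j α (α i) (α j + 1) (α i) (α j + 1) U +
      ((α j + 1 : ℕ) * columnMonomial l i j α (α i + 1) (α j) (α i + 1) (α j) U -
        α i * columnMonomial l i j α (α i + 1) (α j) (α i - 1) (α j + 2) U))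
    (hcont (α i + 1) (α j) (α i) (α j + 1)) (by fun_prop) (planeRotation i j hij)
    (hasDerivAt_columnMonomial_planeRotation_mul hij l α (α i + 1) (α j) (α i) (α j + 1))
  have hvanish : (α i : ℂ) *
      ∫ U, columnMonomial l i j α (α i + 1) (α j) (α i - 1) (α j + 2) U ∂μ = 0 := by
    rcases α i with _ | m
    · simp
    · rw [Nat.add_sub_cancel, integral_columnMonomial_eq_zero μ hij, mul_zero]
  have hj : (columnMoment μ l (α + Pi.single j 1) : ℂ) =
      ∫ U, columnMonomial l i j α (α i) (α j + 1) (α i) (α j + 1) U ∂μ := by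
    rw [ofReal_columnMoment μ l hij (β := α) fun k _ hk => by simp [hk]]
    simp [hij]
  have hi : (columnMoment μ l (α + Pi.single i 1) : ℂ) =
      ∫ U, columnMonomial l i j α (α i + 1) (α j) (α i + 1) (α j) U ∂μ := by
    rw [ofReal_columnMoment μ l hij (β := α) fun k hk _ => by simp [hk]]
    simp [hij.symm]
  rw [integral_add (hsub_int _ _ _ _ _ _ _ _ _ _) (hsub_int _ _ _ _ _ _ _ _ _ _),
    integral_sub (h_int _ _ _ _ _) (h_int _ _ _ _ _),
    integral_sub (h_int _ _ _ _ _) (h_int _ _ _ _ _), integral_const_mul, integral_const_mul,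
    integral_const_mul, integral_const_mul, integral_columnMonomial_eq_zero μ hij, hvanish, ← hi,
    ← hj] at hzero
  have hreal : α j * 0 - (α i + 1 : ℕ) * columnMoment μ l (α + Pi.single j 1) +
      ((α j + 1 : ℕ) * columnMoment μ l (α + Pi.single i 1) - 0) = 0 := by exact_mod_cast hzero
  push_cast at hreal
  linarith

lemma sum_columnMoment_add_single (μ : Measure (unitaryGroup ι ℂ)) [IsFiniteMeasure μ]
    (l : ι) (α : ι → ℕ) :
    ∑ i, columnMoment μ l (α + Pi.single i 1) = columnMoment μ l α := by
  have hcont (k : ι) : Continuous fun U : unitaryGroup ι ℂ => U k l := continuous_apply k l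
  have h_int (i : ι) : Integrable (fun U : unitaryGroup ι ℂ =>
      ∏ k, ‖U k l‖ ^ (2 * (α + Pi.single i 1 : ι → ℕ) k)) μ :=
    (continuous_finsetProd _ fun k _ => (hcont k).norm.pow _).integrable_of_hasCompactSupport
      (HasCompactSupport.of_compactSpace _)
  unfold columnMoment
  rw [← integral_finsetSum _ fun i _ => h_int i]
  refine integral_congr_ae (.of_forall fun U => ?_)
  have hterm (i : ι) : ∏ k, ‖U k l‖ ^ (2 * (α + Pi.single i 1 : ι → ℕ) k) =
      (∏ k, ‖U k l‖ ^ (2 * α k)) * ‖U i l‖ ^ 2 := by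
    simp only [Pi.add_apply, mul_add, pow_add, Finset.prod_mul_distrib]
    congr 1
    rw [Finset.prod_eq_single i (fun k _ hk => by simp [hk]) (by simp)]
    simp
  simp only [hterm, ← Finset.mul_sum, sum_norm_sq_column, mul_one]

lemma columnMoment_add_single (μ : Measure (unitaryGroup ι ℂ)) [IsFiniteMeasure μ]
    [μ.IsMulLeftInvariant] (l : ι) (α : ι → ℕ) (i : ι) :
    (∑ k, α k + Fintype.card ι : ℕ) * columnMoment μ l (α + Pi.single i 1) =
      (α i + 1) * columnMoment μ l α := by
  rw [← sum_columnMoment_add_single μ l α, Finset.mul_sum,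
    Finset.sum_congr rfl fun j _ => columnMoment_add_single_comm μ l α i j, ← Finset.sum_mul]
  simp [Finset.sum_add_distrib]

theorem columnMoment_mul_factorial (μ : Measure (unitaryGroup ι ℂ)) [IsProbabilityMeasure μ]
    [μ.IsMulLeftInvariant] (l : ι) (α : ι → ℕ) :
    columnMoment μ l α * (∑ k, α k + Fintype.card ι - 1).factorial =
      (∏ k, ((α k).factorial : ℝ)) * (Fintype.card ι - 1).factorial := by
  induction hd : ∑ k, α k generalizing α with
  | zero =>
    have hα : α = 0 := by
      ext k
      simpa using (Finset.sum_eq_zero_iff.mp hd) k (Finset.mem_univ k)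
    simp [hα, columnMoment]
  | succ d ih =>
    obtain ⟨i, -, hi⟩ : ∃ i ∈ Finset.univ, α i ≠ 0 :=
      Finset.exists_ne_zero_of_sum_ne_zero (by omega)
    obtain ⟨β, rfl⟩ : ∃ β : ι → ℕ, α = β + Pi.single i 1 := by
      refine ⟨α - Pi.single i 1, funext fun k => ?_⟩
      obtain rfl | hk := eq_or_ne k i
      · simp
        omega
      · simp [hk]
    have hβ : ∑ k, β k = d := by
      simpa [Finset.sum_add_distrib] using hd
    have hcard : 0 < Fintype.card ι := Fintype.card_pos_iff.mpr ⟨l⟩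
    have hprod : ∏ k, (((β + Pi.single i 1 : ι → ℕ) k).factorial : ℝ) =
        (β i + 1) * ∏ k, ((β k).factorial : ℝ) := by
      rw [← Finset.mul_prod_erase _ _ (Finset.mem_univ i),
        ← Finset.mul_prod_erase Finset.univ (fun k => ((β k).factorial : ℝ)) (Finset.mem_univ i),
        Finset.prod_congr rfl fun k hk => by
          rw [Pi.add_apply, Pi.single_eq_of_ne (Finset.ne_of_mem_erase hk), add_zero]]
      simp [Nat.factorial_succ]
      ring
    have hstep := columnMoment_add_single μ l β i
    have hfac : (d + 1 + Fintype.card ι - 1).factorial =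
        (d + Fintype.card ι) * (d + Fintype.card ι - 1).factorial := by
      rw [show d + 1 + Fintype.card ι - 1 = d + Fintype.card ι by omega]
      exact (Nat.mul_factorial_pred (by omega)).symm
    rw [hβ] at hstep
    rw [hprod, hfac, Nat.cast_mul]
    linear_combination ((d + Fintype.card ι - 1).factorial : ℝ) * hstep + (β i + 1) * ih β hβ

end Matrix.UnitaryGroup

/-- Bombieri inner product formula: for nonnegative integers `α` with `Σᵢ αᵢ = d`,
the Haar-average over `U(n)` of `∏ᵢ |Uᵢ₁|^{2αᵢ}` equals `α₁!⋯αₙ!(n−1)!/(d+n−1)!`. -/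
theorem integral_prod_pow_abs_first_column
    (n : ℕ) (hn : 1 ≤ n)
    (μ : Measure (Matrix.unitaryGroup (Fin n) ℂ))
    [μ.IsHaarMeasure] [IsProbabilityMeasure μ]
    (α : Fin n → ℕ) (d : ℕ) (hd : ∑ i, α i = d) :
    (∫ U : Matrix.unitaryGroup (Fin n) ℂ,
        ∏ i, ‖(U : Matrix (Fin n) (Fin n) ℂ) i (⟨0, hn⟩ : Fin n)‖ ^ (2 * α i) ∂μ)
      = (∏ i, (Nat.factorial (α i) : ℝ)) * (Nat.factorial (n - 1) : ℝ) /
          (Nat.factorial (d + n - 1) : ℝ) := by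
  have : BorelSpace (Matrix (Fin n) (Fin n) ℂ) := ⟨rfl⟩
  rw [eq_div_iff (by positivity), ← hd]
  simpa [Matrix.UnitaryGroup.columnMoment] using
    Matrix.UnitaryGroup.columnMoment_mul_factorial μ ⟨0, hn⟩ α
end

section
/- Let n ≥ 2, let μ be the Haar probability measure on the unitary group U(n), and let f : ℝⁿ → ℝ be a continuous function. Then ∫_{U(n)} f(|U₁₁|², …, |Uₙ₁|²) dμ(U) = (n−1)! · ∫₀¹ ∫₀^{1−x₁} ⋯ ∫₀^{1−x₁−⋯−x_{n−2}} f(x₁, …, x_{n−1}, 1−x₁−⋯−x_{n−1}) dx_{n−1} ⋯ dx₂ dx₁. -/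
open Matrix MeasureTheory

/-- Lebesgue measure on `ℂ`, scaled so that its image under `z ↦ ‖z‖ ^ 2` is the restriction of
Lebesgue measure to the nonnegative half-line. -/
noncomputable def scaledArea : Measure ℂ := (ENNReal.ofReal Real.pi)⁻¹ • volume

instance : scaledArea.IsAddHaarMeasure :=
  Measure.IsAddHaarMeasure.smul _ (by simp) (by simp [Real.pi_pos])

theorem lintegral_comp_norm_sq (g : ℝ → ENNReal) (hg : Measurable g) :
    ∫⁻ z : ℂ, g (‖z‖ ^ 2) = ENNReal.ofReal Real.pi * ∫⁻ t in Set.Ioi 0, g t := by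
  have himage : (fun r : ℝ => r ^ 2) '' Set.Ioi 0 = Set.Ioi 0 := by
    ext t
    constructor
    · rintro ⟨r, hr, rfl⟩
      exact pow_pos (Set.mem_Ioi.1 hr) 2
    · intro ht
      exact ⟨√t, Real.sqrt_pos.2 ht, Real.sq_sqrt (Set.mem_Ioi.1 ht).le⟩
  have hsubst := lintegral_image_eq_lintegral_abs_deriv_mul (s := Set.Ioi (0 : ℝ))
    (f := fun r => r ^ 2) (f' := fun r => 2 * r) measurableSet_Ioi
    (fun x _ => by simpa using (hasDerivAt_pow 2 x).hasDerivWithinAt)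
    (fun x hx y hy h =>
      (pow_left_inj₀ (Set.mem_Ioi.1 hx).le (Set.mem_Ioi.1 hy).le two_ne_zero).1 h) g
  rw [himage] at hsubst
  rw [← Complex.lintegral_comp_polarCoord_symm, polarCoord_target, hsubst, Measure.volume_eq_prod,
    ← Measure.prod_restrict]
  simp only [Complex.norm_polarCoord_symm, sq_abs, smul_eq_mul]
  rw [lintegral_prod _ (by fun_prop)]
  simp only [lintegral_const]
  rw [← lintegral_const_mul _ (by fun_prop)]
  refine setLIntegral_congr_fun measurableSet_Ioi fun r hr => ?_
  have hr : 0 < r := hr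
  simp only [MeasurableSet.univ, Measure.restrict_apply, Set.univ_inter, Real.volume_Ioo]
  rw [abs_of_pos (by positivity), ENNReal.ofReal_mul zero_le_two,
    show Real.pi - -Real.pi = 2 * Real.pi by ring, ENNReal.ofReal_mul zero_le_two]
  ring

theorem map_norm_sq_scaledArea :
    scaledArea.map (fun z => ‖z‖ ^ 2) = volume.restrict (Set.Ici (0 : ℝ)) := by
  refine Measure.ext_of_lintegral _ fun g hg => ?_
  rw [lintegral_map hg (by fun_prop), scaledArea, lintegral_smul_measure,
    lintegral_comp_norm_sq g hg, smul_eq_mul, ← mul_assoc,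
    ENNReal.inv_mul_cancel (by simp [Real.pi_pos]) (by simp), one_mul,
    restrict_Ioi_eq_restrict_Ici]

theorem map_norm_sq_pi_scaledArea (ι : Type*) [Fintype ι] :
    (Measure.pi fun _ : ι => scaledArea).map (fun z i => ‖z i‖ ^ 2) =
      volume.restrict (Set.univ.pi fun _ => Set.Ici (0 : ℝ)) := by
  have : SigmaFinite (scaledArea.map (fun z => ‖z‖ ^ 2)) := by
    rw [map_norm_sq_scaledArea]; infer_instance
  rw [Measure.pi_map_pi (f := fun _ (z : ℂ) => ‖z‖ ^ 2) (fun _ => by fun_prop), volume_pi,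
    Measure.restrict_pi_pi,
    map_norm_sq_scaledArea]

theorem map_mulVec_unitary {ι : Type*} [Fintype ι] [DecidableEq ι] (ν : Measure (ι → ℂ))
    [ν.IsAddHaarMeasure] (U : Matrix.unitaryGroup ι ℂ) :
    ν.map ((U : Matrix ι ι ℂ) *ᵥ ·) = ν := by
  have hdet : |LinearMap.det ((Matrix.toLin' (U : Matrix ι ι ℂ)).restrictScalars ℝ)| = 1 := by
    rw [LinearMap.det_restrictScalars, LinearMap.det_toLin', Algebra.norm_complex_apply,
      Complex.normSq_eq_norm_sq]
    have := (Matrix.det_of_mem_unitary U.2)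
    rw [Unitary.mem_iff_star_mul_self] at this
    have h2 := congrArg norm this
    rw [norm_mul, norm_star, norm_one] at h2
    rw [sq, h2, abs_one]
  have := Measure.map_linearMap_addHaar_eq_smul_addHaar ν
    (f := (Matrix.toLin' (U : Matrix ι ι ℂ)).restrictScalars ℝ)
    (by intro h; simp [h] at hdet)
  rw [abs_inv, hdet] at this
  rw [inv_one, ENNReal.ofReal_one, one_smul] at this
  exact this

theorem lintegral_pi_exp_neg (ι : Type*) [Fintype ι] :
    ∫⁻ x in Set.univ.pi (fun _ : ι => Set.Ici (0 : ℝ)),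
      ENNReal.ofReal (Real.exp (-∑ i, x i)) = 1 := by
  have hint : Integrable (fun t : ℝ => Real.exp (-t)) (volume.restrict (Set.Ici 0)) := by
    rw [← restrict_Ioi_eq_restrict_Ici]
    exact integrableOn_exp_neg_Ioi 0
  rw [volume_pi, Measure.restrict_pi_pi]
  simp_rw [← Finset.sum_neg_distrib, Real.exp_sum]
  rw [← ofReal_integral_eq_lintegral_ofReal (Integrable.fintype_prod fun _ => hint)
    (ae_of_all _ fun x => by positivity),
    integral_fintype_prod_eq_prod (fun _ t => Real.exp (-t))]
  simp only [← restrict_Ioi_eq_restrict_Ici, integral_exp_neg_Ioi_zero, Finset.prod_const_one,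
    ENNReal.ofReal_one]

theorem lintegral_comp_inv_smul {m : ℕ} {s : ℝ} (hs : 0 < s) (G : (Fin m → ℝ) → ENNReal)
    (hG : Measurable G) :
    ∫⁻ y, G (s⁻¹ • y) = ENNReal.ofReal (s ^ m) * ∫⁻ w, G w := by
  rw [← lintegral_map hG (measurable_const_smul s⁻¹),
    Measure.map_addHaar_smul volume (inv_ne_zero hs.ne'), lintegral_smul_measure]
  simp [abs_of_pos hs]

theorem lintegral_exp_neg_mul_pow (m : ℕ) :
    ∫⁻ s in Set.Ioi (0 : ℝ), ENNReal.ofReal (Real.exp (-s)) * ENNReal.ofReal (s ^ m) =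
      (m.factorial : ENNReal) := by
  have hpow : ∀ s : ℝ, s ^ ((m + 1 : ℝ) - 1) = s ^ m := fun s => by simp
  have hint := Real.GammaIntegral_convergent (s := m + 1) (by positivity)
  have hval := Real.Gamma_eq_integral (s := m + 1) (by positivity)
  simp_rw [hpow] at hint hval
  simp_rw [← ENNReal.ofReal_mul (Real.exp_pos _).le]
  rw [← ofReal_integral_eq_lintegral_ofReal hint
    ((ae_restrict_mem measurableSet_Ioi).mono fun s hs => by
      have : 0 < s := hs
      simp only [Pi.zero_apply]; positivity),
    ← hval, Real.Gamma_nat_eq_factorial, ENNReal.ofReal_natCast]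

/-- The solid simplex `{x | 0 ≤ x, ∑ i, x i ≤ 1}` in `ℝᵐ`. -/
def solidSimplex (m : ℕ) : Set (Fin m → ℝ) := {x | (∀ i, 0 ≤ x i) ∧ ∑ i, x i ≤ 1}

theorem measurableSet_solidSimplex (m : ℕ) : MeasurableSet (solidSimplex m) := by
  unfold solidSimplex
  measurability

theorem lintegral_eq_lintegral_snoc {m : ℕ} (F : (Fin (m + 1) → ℝ) → ENNReal) (hF : Measurable F) :
    ∫⁻ x, F x = ∫⁻ s : ℝ, ∫⁻ y : Fin m → ℝ, F (Fin.snoc y (s - ∑ i, y i)) := by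
  have hsnoc : Measurable fun p : ℝ × (Fin m → ℝ) =>
      (Fin.snoc p.2 (p.1 - ∑ i, p.2 i) : Fin (m + 1) → ℝ) := by
    refine measurable_pi_lambda _ fun i => ?_
    refine Fin.lastCases ?_ (fun j => ?_) i
    · simp only [Fin.snoc_last]; fun_prop
    · simp only [Fin.snoc_castSucc]; fun_prop
  have hsnoc' : Measurable fun p : ℝ × (Fin m → ℝ) =>
      (Fin.snoc p.2 p.1 : Fin (m + 1) → ℝ) := by
    refine measurable_pi_lambda _ fun i => ?_
    refine Fin.lastCases ?_ (fun j => ?_) i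
    · simp only [Fin.snoc_last]; fun_prop
    · simp only [Fin.snoc_castSucc]; fun_prop
  have h1 := ((volume_preserving_piFinSuccAbove (fun _ : Fin (m + 1) => ℝ) (Fin.last m)).symm
    ).lintegral_comp hF
  have h2 : ∀ p : ℝ × (Fin m → ℝ),
      (MeasurableEquiv.piFinSuccAbove (fun _ : Fin (m + 1) => ℝ) (Fin.last m)).symm p =
        Fin.snoc p.2 p.1 := fun p => by
    simp [MeasurableEquiv.piFinSuccAbove, Fin.insertNthEquiv, Fin.insertNth_last']
  simp_rw [h2] at h1
  rw [← h1, Measure.volume_eq_prod, lintegral_prod_symm _ (by exact (hF.comp hsnoc').aemeasurable)]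
  refine Eq.trans ?_ (lintegral_lintegral_swap
    (f := fun (s : ℝ) (y : Fin m → ℝ) => F (Fin.snoc y (s - ∑ i, y i)))
    (hF.comp hsnoc).aemeasurable).symm
  refine lintegral_congr fun y => ?_
  exact (lintegral_sub_right_eq_self (fun t : ℝ => F (Fin.snoc y t)) (∑ i, y i)).symm

theorem measurable_snoc_one_sub_sum (m : ℕ) : Measurable fun y : Fin m → ℝ =>
    (Fin.snoc y (1 - ∑ i, y i) : Fin (m + 1) → ℝ) := by
  refine measurable_pi_lambda _ fun i => ?_
  refine Fin.lastCases ?_ (fun j => ?_) i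
  · simp only [Fin.snoc_last]; fun_prop
  · simp only [Fin.snoc_castSucc]; fun_prop

theorem lintegral_pi_exp_neg_mul_normalize {m : ℕ} (h : (Fin (m + 1) → ℝ) → ENNReal)
    (hh : Measurable h) :
    ∫⁻ x in Set.univ.pi (fun _ : Fin (m + 1) => Set.Ici (0 : ℝ)),
        ENNReal.ofReal (Real.exp (-∑ i, x i)) * h ((∑ i, x i)⁻¹ • x) =
      m.factorial * ∫⁻ y in solidSimplex m, h (Fin.snoc y (1 - ∑ i, y i)) := by
  have hmeas : MeasurableSet (Set.univ.pi (fun _ : Fin (m + 1) => Set.Ici (0 : ℝ))) :=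
    MeasurableSet.univ_pi fun _ => measurableSet_Ici
  have hG : Measurable ((solidSimplex m).indicator fun y => h (Fin.snoc y (1 - ∑ i, y i))) :=
    (hh.comp (measurable_snoc_one_sub_sum m)).indicator (measurableSet_solidSimplex m)
  have hx : Measurable fun x : Fin (m + 1) → ℝ => (∑ i, x i)⁻¹ • x := by fun_prop
  have hF : Measurable fun x : Fin (m + 1) → ℝ =>
      ENNReal.ofReal (Real.exp (-∑ i, x i)) * h ((∑ i, x i)⁻¹ • x) :=
    (by fun_prop : Measurable fun x : Fin (m + 1) → ℝ =>
      ENNReal.ofReal (Real.exp (-∑ i, x i))).mul (hh.comp hx)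
  rw [← lintegral_indicator hmeas, lintegral_eq_lintegral_snoc _ (hF.indicator hmeas)]
  have hsum : ∀ (s : ℝ) (y : Fin m → ℝ),
      ∑ i, (Fin.snoc y (s - ∑ i, y i) : Fin (m + 1) → ℝ) i = s := fun s y => by
    simp [Fin.sum_univ_castSucc]
  rw [← lintegral_indicator (measurableSet_solidSimplex m), ← lintegral_exp_neg_mul_pow,
    ← lintegral_mul_const _ (by fun_prop), ← lintegral_indicator measurableSet_Ioi]
  refine lintegral_congr_ae ?_
  filter_upwards [Measure.ae_ne volume (0 : ℝ)] with s hs0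
  rcases lt_or_gt_of_ne hs0 with hs | hs
  · rw [Set.indicator_of_notMem (by simpa using hs.le)]
    refine (lintegral_congr fun y => ?_).trans lintegral_zero
    refine Set.indicator_of_notMem (fun hy => ?_) _
    have : 0 ≤ ∑ i, (Fin.snoc y (s - ∑ i, y i) : Fin (m + 1) → ℝ) i :=
      Finset.sum_nonneg fun i _ => hy i trivial
    rw [hsum] at this
    linarith
  · rw [Set.indicator_of_mem (show s ∈ Set.Ioi 0 from hs), mul_assoc,
      ← lintegral_comp_inv_smul hs _ hG,
      ← lintegral_const_mul _ (by exact hG.comp (measurable_const_smul s⁻¹))]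
    refine lintegral_congr fun y => ?_
    have hmem : (Fin.snoc y (s - ∑ i, y i) : Fin (m + 1) → ℝ) ∈
        Set.univ.pi (fun _ : Fin (m + 1) => Set.Ici (0 : ℝ)) ↔ s⁻¹ • y ∈ solidSimplex m := by
      simp only [Set.mem_univ_pi, Set.mem_Ici, Fin.forall_fin_succ', Fin.snoc_castSucc,
        Fin.snoc_last, solidSimplex, Set.mem_ofPred_eq, Pi.smul_apply, smul_eq_mul,
        ← Finset.mul_sum]
      refine and_congr (forall_congr' fun i => ?_) ?_
      · exact (mul_nonneg_iff_of_pos_left (inv_pos.2 hs)).symm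
      · rw [inv_mul_le_iff₀ hs, mul_one, sub_nonneg]
    have hvec : s⁻¹ • (Fin.snoc y (s - ∑ i, y i) : Fin (m + 1) → ℝ) =
        Fin.snoc (s⁻¹ • y) (1 - ∑ i, (s⁻¹ • y) i) := by
      funext i
      refine Fin.lastCases ?_ (fun j => ?_) i
      · simp [← Finset.mul_sum, mul_sub, hs.ne']
      · simp
    by_cases hy : s⁻¹ • y ∈ solidSimplex m
    · rw [Set.indicator_of_mem (hmem.2 hy), Set.indicator_of_mem hy, hsum, hvec]
    · rw [Set.indicator_of_notMem (mt hmem.1 hy), Set.indicator_of_notMem hy, mul_zero]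

instance (n : ℕ) : BorelSpace (Matrix (Fin n) (Fin n) ℂ) := ⟨rfl⟩

instance (n : ℕ) : SecondCountableTopology (Matrix (Fin n) (Fin n) ℂ) :=
  inferInstanceAs (SecondCountableTopology (Fin n → Fin n → ℂ))

instance (n : ℕ) : BorelSpace (Matrix.unitaryGroup (Fin n) ℂ) := Subtype.borelSpace _

instance (n : ℕ) : SecondCountableTopology (Matrix.unitaryGroup (Fin n) ℂ) :=
  TopologicalSpace.Subtype.secondCountableTopology _

instance (n : ℕ) : IsTopologicalGroup (Matrix.unitaryGroup (Fin n) ℂ) :=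
  inferInstanceAs (IsTopologicalGroup (unitary (Matrix (Fin n) (Fin n) ℂ)))

instance (n : ℕ) : CompactSpace (Matrix.unitaryGroup (Fin n) ℂ) := by
  have hcompact : IsCompact (Set.univ.pi fun _ => Set.univ.pi fun _ => Metric.closedBall 0 1 :
      Set (Matrix (Fin n) (Fin n) ℂ)) :=
    isCompact_univ_pi fun _ => isCompact_univ_pi fun _ => isCompact_closedBall _ _
  have hclosed : IsClosed (unitary (Matrix (Fin n) (Fin n) ℂ) : Set (Matrix (Fin n) (Fin n) ℂ)) :=
    isClosed_unitary
  refine isCompact_iff_compactSpace.1 (hcompact.of_isClosed_subset hclosed ?_)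
  intro U hU i _ j _
  simpa using entry_norm_bound_of_unitary hU i j

instance (n : ℕ) (μ : Measure (Matrix.unitaryGroup (Fin n) ℂ)) [μ.IsHaarMeasure]
    [IsProbabilityMeasure μ] : μ.IsMulRightInvariant := by
  refine ⟨fun g => ?_⟩
  have : IsProbabilityMeasure (μ.map (· * g)) :=
    Measure.isProbabilityMeasure_map (by fun_prop)
  exact Measure.isHaarMeasure_eq_of_isProbabilityMeasure _ _

theorem exists_unitary_mulVec_single {n : ℕ} (j : Fin n) (z : EuclideanSpace ℂ (Fin n))
    (hz : ‖z‖ = 1) :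
    ∃ V : Matrix.unitaryGroup (Fin n) ℂ, ∀ i, (V : Matrix (Fin n) (Fin n) ℂ) i j = z i := by
  obtain ⟨b, hb⟩ := Orthonormal.exists_orthonormalBasis_extension_of_card_eq (𝕜 := ℂ)
    (ι := Fin n) (E := EuclideanSpace ℂ (Fin n)) (by simp) (v := fun _ => z) (s := {j})
    ⟨fun _ => hz, fun i k hik => (hik (Subsingleton.elim i k)).elim⟩
  refine ⟨⟨_, (EuclideanSpace.basisFun (Fin n) ℂ).toMatrix_orthonormalBasis_mem_unitary b⟩,
    fun i => ?_⟩
  simp [Module.Basis.toMatrix_apply, hb j rfl]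

theorem lintegral_unitary_mulVec_eq {n : ℕ} (j : Fin n)
    (μ : Measure (Matrix.unitaryGroup (Fin n) ℂ)) [μ.IsMulRightInvariant]
    (h : (Fin n → ℝ) → ENNReal) (z : Fin n → ℂ) (hz : z ≠ 0) :
    ∫⁻ U, h ((∑ i, ‖z i‖ ^ 2)⁻¹ •
        fun i => ‖((U : Matrix (Fin n) (Fin n) ℂ) *ᵥ z) i‖ ^ 2) ∂μ =
      ∫⁻ U, h (fun i => ‖(U : Matrix (Fin n) (Fin n) ℂ) i j‖ ^ 2) ∂μ := by
  set w : EuclideanSpace ℂ (Fin n) := WithLp.toLp 2 z with hw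
  have hw0 : w ≠ 0 := by simpa [hw] using hz
  have hwn : ‖w‖ ≠ 0 := norm_ne_zero_iff.2 hw0
  obtain ⟨V, hV⟩ := exists_unitary_mulVec_single j (((‖w‖⁻¹ : ℝ) : ℂ) • w) (by
    rw [norm_smul, Complex.norm_real, norm_inv, norm_norm, inv_mul_cancel₀ hwn])
  rw [← lintegral_mul_right_eq_self (μ := μ)
    (fun U => h (fun i => ‖(U : Matrix (Fin n) (Fin n) ℂ) i j‖ ^ 2)) V]
  refine lintegral_congr fun U => congrArg h (funext fun i => ?_)
  have hentry : ((U * V : Matrix.unitaryGroup (Fin n) ℂ) : Matrix (Fin n) (Fin n) ℂ) i j =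
      ((‖w‖⁻¹ : ℝ) : ℂ) * ((U : Matrix (Fin n) (Fin n) ℂ) *ᵥ z) i := by
    rw [Submonoid.coe_mul, Matrix.mul_apply, Matrix.mulVec, dotProduct, Finset.mul_sum]
    refine Finset.sum_congr rfl fun k _ => ?_
    rw [hV k, PiLp.smul_apply, smul_eq_mul]
    ring
  rw [hentry, norm_mul, mul_pow, Complex.norm_real, norm_inv, norm_norm, inv_pow,
    EuclideanSpace.norm_sq_eq]
  rfl

theorem sum_norm_sq_mulVec_unitary {n : ℕ} (U : Matrix.unitaryGroup (Fin n) ℂ) (z : Fin n → ℂ) :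
    ∑ i, ‖((U : Matrix (Fin n) (Fin n) ℂ) *ᵥ z) i‖ ^ 2 = ∑ i, ‖z i‖ ^ 2 := by
  have key : ∀ v : Fin n → ℂ, ((∑ i, ‖v i‖ ^ 2 : ℝ) : ℂ) = star v ⬝ᵥ v := fun v => by
    simp [dotProduct, Complex.conj_mul']
  apply Complex.ofReal_injective
  rw [key, key, Matrix.star_mulVec, ← Matrix.dotProduct_mulVec, Matrix.mulVec_mulVec,
    ← Matrix.star_eq_conjTranspose, Matrix.UnitaryGroup.star_mul_self, Matrix.one_mulVec]

theorem measurable_unitary_column_norm_sq {n : ℕ} (j : Fin n) :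
    Measurable fun (U : Matrix.unitaryGroup (Fin n) ℂ) i =>
      ‖(U : Matrix (Fin n) (Fin n) ℂ) i j‖ ^ 2 := by
  refine Continuous.measurable (continuous_pi fun i => ?_)
  exact (continuous_subtype_val.matrix_elem i j).norm.pow 2

theorem lintegral_unitary_column_eq {m : ℕ} (j : Fin (m + 1))
    (μ : Measure (Matrix.unitaryGroup (Fin (m + 1)) ℂ)) [μ.IsHaarMeasure]
    [IsProbabilityMeasure μ] (h : (Fin (m + 1) → ℝ) → ENNReal) (hh : Measurable h) :
    ∫⁻ U, h (fun i => ‖(U : Matrix (Fin (m + 1)) (Fin (m + 1)) ℂ) i j‖ ^ 2) ∂μ =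
      m.factorial * ∫⁻ y in solidSimplex m, h (Fin.snoc y (1 - ∑ i, y i)) := by
  set ν : Measure (Fin (m + 1) → ℂ) := Measure.pi fun _ => scaledArea with hν
  set g : (Fin (m + 1) → ℝ) → ENNReal := fun x =>
    ENNReal.ofReal (Real.exp (-∑ i, x i)) * h ((∑ i, x i)⁻¹ • x) with hg_def
  have hexp : Measurable fun x : Fin (m + 1) → ℝ => ENNReal.ofReal (Real.exp (-∑ i, x i)) := by
    fun_prop
  have hg : Measurable g :=
    hexp.mul (hh.comp (by fun_prop : Measurable fun x : Fin (m + 1) → ℝ => (∑ i, x i)⁻¹ • x))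
  have hsq : Measurable fun (z : Fin (m + 1) → ℂ) i => ‖z i‖ ^ 2 := by fun_prop
  have hlintegral_g : ∫⁻ z, g (fun i => ‖z i‖ ^ 2) ∂ν =
      m.factorial * ∫⁻ y in solidSimplex m, h (Fin.snoc y (1 - ∑ i, y i)) := by
    rw [← lintegral_map hg hsq, hν, map_norm_sq_pi_scaledArea,
      lintegral_pi_exp_neg_mul_normalize h hh]
  have hlintegral_exp : ∫⁻ z, ENNReal.ofReal (Real.exp (-∑ i, ‖z i‖ ^ 2)) ∂ν = 1 := by
    have := lintegral_map (μ := ν) hexp hsq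
    rw [← this, hν, map_norm_sq_pi_scaledArea, lintegral_pi_exp_neg]
  have haverage : ∀ᵐ z ∂ν, ∫⁻ U : Matrix.unitaryGroup (Fin (m + 1)) ℂ,
      g (fun i => ‖((U : Matrix (Fin (m + 1)) (Fin (m + 1)) ℂ) *ᵥ z) i‖ ^ 2) ∂μ =
      ENNReal.ofReal (Real.exp (-∑ i, ‖z i‖ ^ 2)) *
        ∫⁻ U, h (fun i => ‖(U : Matrix (Fin (m + 1)) (Fin (m + 1)) ℂ) i j‖ ^ 2) ∂μ := by
    filter_upwards [Measure.ae_ne ν 0] with z hz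
    rw [← lintegral_unitary_mulVec_eq j μ h z hz,
      ← lintegral_const_mul' _ _ ENNReal.ofReal_ne_top]
    simp only [hg_def, sum_norm_sq_mulVec_unitary]
  have hcont : Continuous fun p : (Fin (m + 1) → ℂ) × Matrix.unitaryGroup (Fin (m + 1)) ℂ =>
      (p.2 : Matrix (Fin (m + 1)) (Fin (m + 1)) ℂ) *ᵥ p.1 :=
    (continuous_subtype_val.comp continuous_snd).matrix_mulVec continuous_fst
  calc ∫⁻ U, h (fun i => ‖(U : Matrix (Fin (m + 1)) (Fin (m + 1)) ℂ) i j‖ ^ 2) ∂μ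
      = ∫⁻ z, ∫⁻ U : Matrix.unitaryGroup (Fin (m + 1)) ℂ,
          g (fun i => ‖((U : Matrix (Fin (m + 1)) (Fin (m + 1)) ℂ) *ᵥ z) i‖ ^ 2) ∂μ ∂ν := by
        rw [lintegral_congr_ae haverage, lintegral_mul_const _ (by exact hexp.comp hsq),
          hlintegral_exp, one_mul]
    _ = ∫⁻ U : Matrix.unitaryGroup (Fin (m + 1)) ℂ, ∫⁻ z,
          g (fun i => ‖((U : Matrix (Fin (m + 1)) (Fin (m + 1)) ℂ) *ᵥ z) i‖ ^ 2) ∂ν ∂μ :=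
        lintegral_lintegral_swap ((hg.comp hsq).comp hcont.measurable).aemeasurable
    _ = ∫⁻ _U : Matrix.unitaryGroup (Fin (m + 1)) ℂ, ∫⁻ z, g (fun i => ‖z i‖ ^ 2) ∂ν ∂μ := by
        refine lintegral_congr fun U => ?_
        conv_rhs => rw [← map_mulVec_unitary ν U]
        exact (lintegral_map (hg.comp hsq) (by fun_prop)).symm
    _ = _ := by rw [lintegral_const, measure_univ, mul_one, hlintegral_g]

theorem map_unitary_column_norm_sq {m : ℕ} (j : Fin (m + 1))
    (μ : Measure (Matrix.unitaryGroup (Fin (m + 1)) ℂ)) [μ.IsHaarMeasure]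
    [IsProbabilityMeasure μ] :
    μ.map (fun (U : Matrix.unitaryGroup (Fin (m + 1)) ℂ) i =>
      ‖(U : Matrix (Fin (m + 1)) (Fin (m + 1)) ℂ) i j‖ ^ 2) =
      (m.factorial : ENNReal) • (volume.restrict (solidSimplex m)).map
        (fun y => Fin.snoc y (1 - ∑ i, y i)) := by
  refine Measure.ext_of_lintegral _ fun h hh => ?_
  rw [lintegral_map hh (measurable_unitary_column_norm_sq j), lintegral_smul_measure,
    lintegral_map hh (measurable_snoc_one_sub_sum m), lintegral_unitary_column_eq j μ h hh,
    smul_eq_mul]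

/-- For a continuous `f : ℝⁿ → ℝ`, the Haar-average over `U(n)` of
`f(|U₁₁|²,…,|Uₙ₁|²)` equals `(n−1)!` times the Lebesgue integral of
`f(x₁,…,x_{n−1}, 1 − x₁ − ⋯ − x_{n−1})` over the region
`{x ∈ ℝ^{n−1} : xᵢ ≥ 0, Σᵢ xᵢ ≤ 1}`. -/
theorem integral_unitary_first_column_eq_simplex_integral
    (n : ℕ) (hn : 2 ≤ n)
    (μ : Measure (Matrix.unitaryGroup (Fin n) ℂ))
    [μ.IsHaarMeasure] [IsProbabilityMeasure μ]
    (f : (Fin n → ℝ) → ℝ) (hf : Continuous f) :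
    (∫ U : Matrix.unitaryGroup (Fin n) ℂ,
        f (fun i => ‖(U : Matrix (Fin n) (Fin n) ℂ) i (⟨0, by omega⟩ : Fin n)‖ ^ 2) ∂μ)
      = (Nat.factorial (n - 1) : ℝ) *
        ∫ x in {x : Fin (n - 1) → ℝ | (∀ i, 0 ≤ x i) ∧ ∑ i, x i ≤ 1},
          f (fun i => if h : (i : ℕ) < n - 1 then x ⟨i, h⟩ else 1 - ∑ j, x j) := by
  obtain ⟨m, rfl⟩ : ∃ m, n = m + 1 := ⟨n - 1, by omega⟩
  have hmap := integral_map (μ := μ) (measurable_unitary_column_norm_sq 0).aemeasurable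
    hf.aestronglyMeasurable
  rw [map_unitary_column_norm_sq, integral_smul_measure,
    integral_map (measurable_snoc_one_sub_sum m).aemeasurable hf.aestronglyMeasurable,
    ENNReal.toReal_natCast, smul_eq_mul] at hmap
  have hsnoc : ∀ x : Fin m → ℝ, (Fin.snoc x (1 - ∑ j, x j) : Fin (m + 1) → ℝ) =
      fun i : Fin (m + 1) => if h : (i : ℕ) < m then x ⟨i, h⟩ else 1 - ∑ j, x j := fun x => rfl
  simp_rw [hsnoc] at hmap
  exact hmap.symm
end

section
/- Let n ≥ 2 and let Λ be an n×n complex Hermitian matrix with eigenvalues λ₁ ≥ ⋯ ≥ λₙ (nonincreasing order, with multiplicity). Let M be an (n−1)×(n−1) Hermitian matrix whose eigenvalues μ₁ ≥ ⋯ ≥ μ_{n−1} (nonincreasing order) interlace those of Λ, i.e. λᵢ ≥ μᵢ ≥ λ_{i+1} for all i = 1,…,n−1. Then there exists an n×n unitary matrix U such that M is the leading (n−1)×(n−1) principal submatrix of U Λ U*. -/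
open Matrix

open Polynomial in
/-- For a monic `p` of degree one more than the number of nodes, the polynomial division of `p` by
the nodal polynomial together with the partial fraction expansion of the remainder. -/
theorem exists_eval_eq_nodal_mul_sub_sum {F ι : Type*} [Field F] [Fintype ι] [DecidableEq ι]
    {v : ι → F} (hv : Function.Injective v) {p : F[X]} (hp : p.Monic)
    (hdeg : p.natDegree = Fintype.card ι + 1) :
    ∃ c : F, ∀ x : F, (∀ i, x ≠ v i) →
      p.eval x = (∏ i, (x - v i)) *
        (x - c - ∑ i, -(p.eval (v i) * Lagrange.nodalWeight Finset.univ v i) / (x - v i)) := by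
  set q : F[X] := Lagrange.nodal Finset.univ v with hq_def
  have hq : q.Monic := Lagrange.nodal_monic
  have hqdeg : q.degree = Fintype.card ι := Lagrange.degree_nodal
  have hquot : (p /ₘ q).Monic := by
    refine (leadingCoeff_divByMonic_of_monic hq ?_).trans hp
    rw [hqdeg, degree_eq_natDegree hp.ne_zero, hdeg]
    exact_mod_cast Nat.le_succ _
  have hquot_deg : (p /ₘ q).natDegree = 1 := by
    rw [natDegree_divByMonic p hq, natDegree_eq_of_degree_eq_some hqdeg, hdeg]
    omega
  have hsplit := modByMonic_add_div p q
  have hrem : p %ₘ q = Lagrange.interpolate Finset.univ v fun i => p.eval (v i) := by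
    refine Lagrange.eq_interpolate_of_eval_eq _ hv.injOn ?_ fun i hi => ?_
    · simpa [hqdeg] using degree_modByMonic_lt p hq
    · have h := congrArg (eval (v i)) hsplit
      rwa [eval_add, eval_mul, hq_def, Lagrange.eval_nodal_at_node hi, zero_mul, add_zero] at h
  refine ⟨-(p /ₘ q).coeff 0, fun x hx => ?_⟩
  have h := congrArg (eval x) hsplit
  rw [hrem, hquot.eq_X_add_C hquot_deg, eval_add, eval_mul,
    Lagrange.eval_interpolate_not_at_node _ fun i _ => hx i, ← mul_add, hq_def,
    Lagrange.eval_nodal] at h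
  rw [← h]
  congr 1
  simp only [eval_add, eval_X, eval_C, neg_div, Finset.sum_neg_distrib, sub_neg_eq_add]
  rw [add_comm]
  congr 1
  exact Finset.sum_congr rfl fun i _ => by ring

/-- Partial fraction form of `∏ (x - l i) / ∏ (x - m i)` when `m` interlaces `l` and the nodes `m i`
are distinct: the weights `w i` are nonnegative. -/
theorem exists_prod_sub_eq_of_interlacing_of_injective {k : ℕ} {l : Fin (k + 1) → ℝ}
    {m : Fin k → ℝ} (hm : Antitone m) (hinj : Function.Injective m)
    (h₁ : ∀ i, m i ≤ l i.castSucc) (h₂ : ∀ i, l i.succ ≤ m i) :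
    ∃ (c : ℝ) (w : Fin k → ℝ), (∀ i, 0 ≤ w i) ∧ ∀ x : ℝ, (∀ i, x ≠ m i) →
      ∏ i, (x - l i) = (∏ i, (x - m i)) * (x - c - ∑ i, w i / (x - m i)) := by
  obtain ⟨c, hc⟩ := exists_eval_eq_nodal_mul_sub_sum hinj
    (p := Lagrange.nodal Finset.univ l) Lagrange.nodal_monic (by simp [Lagrange.natDegree_nodal])
  refine ⟨c, _, fun i => ?_, fun x hx => by rw [← Lagrange.eval_nodal, hc x hx]⟩
  rw [Lagrange.eval_nodal, Lagrange.nodalWeight, Fin.prod_univ_succAbove _ i.castSucc,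
    ← Finset.mul_prod_erase _ _ (Finset.mem_univ i), Fin.succAbove_castSucc_self, mul_assoc,
    mul_assoc, ← Finset.prod_mul_distrib, ← mul_assoc, ← neg_mul, ← neg_mul, neg_sub]
  refine mul_nonneg (mul_nonneg (sub_nonneg.2 (h₁ i)) (sub_nonneg.2 (h₂ i)))
    (Finset.prod_nonneg fun j hj => ?_)
  rcases lt_or_gt_of_ne (Finset.ne_of_mem_erase hj) with hji | hij
  · rw [Fin.succAbove_castSucc_of_lt _ _ hji]
    have := hm hji.le
    exact mul_nonneg_of_nonpos_of_nonpos (by linarith [h₁ j]) (inv_nonpos.2 (by linarith))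
  · rw [Fin.succAbove_castSucc_of_le _ _ hij.le]
    have := hm hij.le
    exact mul_nonneg (by linarith [h₂ j]) (inv_nonneg.2 (by linarith))

/-- Partial fraction form of `∏ (x - l i) / ∏ (x - m i)` with nonnegative weights, when `m`
interlaces `l`. -/
theorem exists_prod_sub_eq_of_interlacing {k : ℕ} {l : Fin (k + 1) → ℝ}
    {m : Fin k → ℝ} (hl : Antitone l) (hm : Antitone m)
    (h₁ : ∀ i, m i ≤ l i.castSucc) (h₂ : ∀ i, l i.succ ≤ m i) :
    ∃ (c : ℝ) (w : Fin k → ℝ), (∀ i, 0 ≤ w i) ∧ ∀ x : ℝ, (∀ i, x ≠ m i) →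
      ∏ i, (x - l i) = (∏ i, (x - m i)) * (x - c - ∑ i, w i / (x - m i)) := by
  induction k with
  | zero =>
    exact exists_prod_sub_eq_of_interlacing_of_injective hm
      (Function.injective_of_subsingleton m) h₁ h₂
  | succ k ih =>
    by_cases hinj : Function.Injective m
    · exact exists_prod_sub_eq_of_interlacing_of_injective hm hinj h₁ h₂
    obtain ⟨i, hi⟩ : ∃ i : Fin (k + 1), m i = l i.succ := by
      simp only [Function.Injective, not_forall] at hinj
      obtain ⟨a, b, hab, hne⟩ := hinj
      wlog hlt : a < b generalizing a b
      · exact this b a hab.symm (Ne.symm hne) ((not_lt.1 hlt).lt_of_ne (Ne.symm hne))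
      refine ⟨a, le_antisymm ?_ (h₂ a)⟩
      rw [hab]
      exact (h₁ b).trans (hl (Fin.succ_le_castSucc_iff.2 hlt))
    have hle (j : Fin k) : i.succ.succAbove j.castSucc ≤ (i.succAbove j).castSucc := by
      rcases lt_or_ge j.castSucc i with hj | hj
      · rw [Fin.succAbove_of_castSucc_lt _ _ hj, Fin.succAbove_of_castSucc_lt]
        exact Fin.castSucc_lt_succ_iff.2 hj.le
      · rw [Fin.succAbove_of_le_castSucc _ _ hj]
        simp only [Fin.le_def, Fin.succAbove]
        split_ifs <;> simp
    obtain ⟨c, w, hw, hcw⟩ := ih (l := l ∘ i.succ.succAbove) (m := m ∘ i.succAbove)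
      (hl.comp_monotone (Fin.strictMono_succAbove _).monotone)
      (hm.comp_monotone (Fin.strictMono_succAbove _).monotone)
      (fun j => (h₁ _).trans (hl (hle j))) (fun j => by
        simpa [Fin.succ_succAbove_succ] using h₂ (i.succAbove j))
    refine ⟨c, i.insertNth 0 w, fun j => ?_, fun x hx => ?_⟩
    · cases j using i.succAboveCases <;> simp [hw]
    · have := hcw x fun j => hx _
      simp only [Function.comp_apply] at this
      rw [Fin.prod_univ_succAbove _ i.succ, Fin.prod_univ_succAbove (fun j => x - m j) i,
        Fin.sum_univ_succAbove _ i, this, hi]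
      simp [mul_assoc]

open Polynomial in
/-- The characteristic polynomial of an arrowhead matrix, from its partial fraction form. -/
theorem charpoly_fromBlocks_diagonal_eq {ι κ : Type*} [Fintype ι] [DecidableEq ι] [Fintype κ]
    {l : κ → ℝ} {m w : ι → ℝ} {c : ℝ} (hw : ∀ i, 0 ≤ w i)
    (h : ∀ x : ℝ, (∀ i, x ≠ m i) →
      ∏ i, (x - l i) = (∏ i, (x - m i)) * (x - c - ∑ i, w i / (x - m i))) :
    (fromBlocks (diagonal fun i => (m i : ℂ)) (of fun i (_ : Unit) => (√(w i) : ℂ))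
      (of fun (_ : Unit) i => (√(w i) : ℂ)) (of fun _ _ => (c : ℂ))).charpoly =
      ∏ i, (X - C (l i : ℂ)) := by
  refine eq_of_infinite_eval_eq _ _ (Set.Infinite.mono ?_
    ((Set.finite_range m).infinite_compl.image Complex.ofReal_injective.injOn))
  rintro _ ⟨x, hx, rfl⟩
  replace hx : ∀ i, x ≠ m i := fun i hi => hx ⟨i, hi.symm⟩
  have hne (i) : (x : ℂ) - m i ≠ 0 := by
    exact_mod_cast sub_ne_zero.2 (hx i)
  let _ : Invertible fun i => (x : ℂ) - m i :=
    ⟨fun i => (x - m i : ℂ)⁻¹, funext fun i => inv_mul_cancel₀ (hne i),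
      funext fun i => mul_inv_cancel₀ (hne i)⟩
  let _ := diagonalInvertible fun i => (x : ℂ) - m i
  have hblocks : scalar (ι ⊕ Unit) (x : ℂ) -
      fromBlocks (diagonal fun i => (m i : ℂ)) (of fun i (_ : Unit) => (√(w i) : ℂ))
        (of fun (_ : Unit) i => (√(w i) : ℂ)) (of fun _ _ => (c : ℂ)) =
      fromBlocks (diagonal fun i => (x : ℂ) - m i) (-of fun i (_ : Unit) => (√(w i) : ℂ))
        (-of fun (_ : Unit) i => (√(w i) : ℂ)) (of fun _ _ => (x - c : ℂ)) := by
    ext (i | i) (j | j)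
    · by_cases hij : i = j <;> simp [hij, diagonal]
    all_goals simp [diagonal]
  have hx' := congrArg (Complex.ofReal) (h x hx)
  push_cast at hx'
  simp only [Set.mem_ofPred_eq, eval_charpoly, eval_prod, eval_sub, eval_X, eval_C, hx', hblocks,
    det_fromBlocks₁₁, det_diagonal, invOf_diagonal_eq]
  congr 1
  rw [det_unique, Matrix.sub_apply, of_apply, Matrix.mul_apply]
  simp only [mul_diagonal, Matrix.neg_apply, of_apply]
  congr 1
  refine Finset.sum_congr rfl fun i _ => ?_
  have hs : (√(w i) : ℂ) * √(w i) = w i := by exact_mod_cast Real.mul_self_sqrt (hw i)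
  change -(√(w i) : ℂ) * (x - m i : ℂ)⁻¹ * -(√(w i) : ℂ) = w i / (x - m i)
  rw [← hs]
  ring

/-- Two Hermitian matrices with the same characteristic polynomial are unitarily similar. -/
theorem Matrix.IsHermitian.exists_unitary_conj_eq {ι : Type*} [Fintype ι] [DecidableEq ι]
    {A B : Matrix ι ι ℂ} (hA : A.IsHermitian) (hB : B.IsHermitian) (h : A.charpoly = B.charpoly) :
    ∃ U ∈ unitaryGroup ι ℂ, B = U * A * Uᴴ := by
  refine ⟨_, (hB.eigenvectorUnitary * star hA.eigenvectorUnitary).2, ?_⟩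
  rw [← star_eq_conjTranspose, ← Unitary.conjStarAlgAut_apply (S := ℂ),
    Unitary.conjStarAlgAut_mul_apply, hA.conjStarAlgAut_star_eigenvectorUnitary,
    (hA.eigenvalues_eq_eigenvalues_iff hB).2 h]
  exact hB.spectral_theorem

/-- A Hermitian matrix can be bordered by one row and column so that the result is Hermitian with
any prescribed spectrum interlaced by that of the original matrix. -/
theorem Matrix.IsHermitian.exists_bordered_of_interlacing {k : ℕ} {M : Matrix (Fin k) (Fin k) ℂ}
    (hM : M.IsHermitian) {l : Fin (k + 1) → ℝ} {m : Fin k → ℝ} (hl : Antitone l) (hm : Antitone m)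
    (e : Equiv.Perm (Fin k)) (he : ∀ i, m i = hM.eigenvalues (e i))
    (h₁ : ∀ i, m i ≤ l i.castSucc) (h₂ : ∀ i, l i.succ ≤ m i) :
    ∃ N : Matrix (Fin k ⊕ Unit) (Fin k ⊕ Unit) ℂ, N.IsHermitian ∧ N.toBlocks₁₁ = M ∧
      N.charpoly = ∏ i, (Polynomial.X - Polynomial.C (l i : ℂ)) := by
  obtain ⟨c, w, hw, hcw⟩ := exists_prod_sub_eq_of_interlacing hl hm h₁ h₂
  have key := charpoly_fromBlocks_diagonal_eq (l := l) (m := hM.eigenvalues) (w := w ∘ e.symm)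
    (c := c) (fun i => hw _) fun x hx => by
      rw [hcw x fun i => he i ▸ hx (e i), ← Equiv.prod_comp e fun i => x - hM.eigenvalues i,
        ← Equiv.sum_comp e fun i => (w ∘ e.symm) i / (x - hM.eigenvalues i)]
      simp [he]
  set D := Matrix.fromBlocks (diagonal fun i => (hM.eigenvalues i : ℂ))
    (of fun i (_ : Unit) => (√((w ∘ e.symm) i) : ℂ))
    (of fun (_ : Unit) i => (√((w ∘ e.symm) i) : ℂ)) (of fun _ _ => (c : ℂ)) with hD
  set V : Matrix (Fin k) (Fin k) ℂ := hM.eigenvectorUnitary.1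
  set W : Matrix (Fin k ⊕ Unit) (Fin k ⊕ Unit) ℂ := Matrix.fromBlocks V 0 0 1 with hW
  have hDherm : D.IsHermitian := by
    refine IsHermitian.fromBlocks ?_ ?_ ?_ <;> ext i j
    · by_cases hij : i = j <;> simp [diagonal, hij, eq_comm]
    all_goals simp
  refine ⟨W * D * Wᴴ, isHermitian_mul_mul_conjTranspose W hDherm, ?_, ?_⟩
  · rw [hW, hD, fromBlocks_conjTranspose, fromBlocks_multiply, fromBlocks_multiply,
      toBlocks_fromBlocks₁₁]
    simp only [Matrix.zero_mul, Matrix.mul_zero, add_zero, conjTranspose_zero]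
    exact (hM.spectral_theorem).symm
  · have hVV : Vᴴ * V = 1 := Unitary.coe_star_mul_self hM.eigenvectorUnitary
    rw [Matrix.charpoly_mul_comm, ← Matrix.mul_assoc, ← key]
    congr 1
    simp [hW, fromBlocks_conjTranspose, fromBlocks_multiply, hVV]

/-- Converse of Cauchy interlacing: if `M` is an `(n−1) × (n−1)` Hermitian matrix
whose nonincreasing eigenvalues interlace those of the `n × n` Hermitian matrix `Λ`,
then `M` is the leading principal submatrix of `U Λ U*` for some unitary `U`. -/
theorem exists_unitary_principal_submatrix_of_interlacing
    (n : ℕ) (hn : 2 ≤ n)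
    (Λ : Matrix (Fin n) (Fin n) ℂ) (hΛ : Λ.IsHermitian)
    (M : Matrix (Fin (n - 1)) (Fin (n - 1)) ℂ) (hM : M.IsHermitian)
    (L : Fin n → ℝ) (Ms : Fin (n - 1) → ℝ)
    (hL : Antitone L) (hMs : Antitone Ms)
    (eL : ∃ e : Equiv.Perm (Fin n), ∀ i, L i = hΛ.eigenvalues (e i))
    (eM : ∃ e : Equiv.Perm (Fin (n - 1)), ∀ i, Ms i = hM.eigenvalues (e i))
    (hinter : ∀ i : Fin (n - 1),
      Ms i ≤ L (Fin.castLE (by omega) i) ∧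
      L ⟨(i : ℕ) + 1, by have := i.isLt; omega⟩ ≤ Ms i) :
    ∃ U ∈ Matrix.unitaryGroup (Fin n) ℂ,
      M = (U * Λ * Uᴴ).submatrix (Fin.castLE (by omega : n - 1 ≤ n))
        (Fin.castLE (by omega : n - 1 ≤ n)) := by
  obtain ⟨k, rfl⟩ : ∃ k, n = k + 1 := ⟨n - 1, by omega⟩
  obtain ⟨e, he⟩ := eM
  obtain ⟨f, hf⟩ := eL
  obtain ⟨N, hN, hNM, hNchar⟩ := hM.exists_bordered_of_interlacing hL hMs e he
    (fun i => (hinter i).1) (fun i => (hinter i).2)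
  let g : Fin k ⊕ Unit ≃ Fin (k + 1) :=
    ((Equiv.refl (Fin k)).sumCongr finOneEquiv.symm).trans finSumFinEquiv
  obtain ⟨U, hU, hUN⟩ := hΛ.exists_unitary_conj_eq (B := reindex g g N) (hN.submatrix _) (by
    rw [charpoly_reindex, hNchar, hΛ.charpoly_eq,
      ← Equiv.prod_comp f fun i =>
        Polynomial.X - Polynomial.C (RCLike.ofReal (hΛ.eigenvalues i) : ℂ)]
    simp [hf])
  refine ⟨U, hU, ?_⟩
  rw [← hUN, ← hNM]
  ext i j
  have hg (i : Fin k) : g.symm (Fin.castLE (Nat.le_succ k) i) = Sum.inl i :=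
    g.symm_apply_eq.2 rfl
  exact (congrArg₂ N (hg i) (hg j)).symm
end
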